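/- Let π be the stationary probability measure of a SVLMC defined by an irreducible probabilized infinite comb, and let Λ(s) = ∑_{w∈W} π(w)^s be the associated Dirichlet series (defined on a suitable vertical open strip of ℂ where all the involved series converge). Then Λ(s) = (1/S(1)^s)·[ ∑_{n≥0} R_n^s + ( ∑_{n≥0} c_n^s )² / ( 1 − ∑_{n≥0} (c_n − c_{n+1})^s ) ], where R_n = ∑_{k≥n} c_k. -/

import Mathlib

open MeasureTheory
open ProbabilityTheory (Kernel IsMarkovKernel)
open scoped ENNReal

namespace VLMC

/-- Left-infinite sequences over the alphabet `{0,1}`; `s 0` is the rightmost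
(most recent) letter, `s 1` the one before it, etc. -/
abbrev L : Type := ℕ → Bool

/-- Append the letter `b` on the right of the left-infinite sequence `s`. -/
def extend (b : Bool) (s : L) : L := fun n => match n with
  | 0 => b
  | k + 1 => s k

/-- Sequences whose letters, read from the rightmost one leftwards, start with `u`. -/
def cylRev (u : List Bool) : Set L := {s | ∀ i < u.length, s i = u.getD i false}

/-- The cylinder `Lw` of left-infinite sequences admitting the finite word `w` as a suffix. -/
def cyl (w : List Bool) : Set L := cylRev w.reverse

/-- `π` is a stationary (invariant) probability measure for the kernel `κ`. -/
def IsStationary (κ : Kernel L L) (π : Measure L) : Prop :=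
  ∀ B : Set L, MeasurableSet B → π B = ∫⁻ s, κ s B ∂π

/-- `cₙ = ∏_{k=0}^{n-1} q_{0ᵏ1}(0)` (with `c₀ = 1`), for the infinite comb. -/
noncomputable def combC (q : ℕ → Bool → ℝ≥0∞) (n : ℕ) : ℝ≥0∞ :=
  ∏ k ∈ Finset.range n, q k false

/-- The left-infinite sequence `0^∞`. -/
def zeroSeq : L := fun _ => false

/-- `κ` is the transition kernel of the VLMC associated with the probabilized
infinite comb whose contexts are the words `0ⁿ1`, `n ≥ 0` (with probability
measures `q n` on the alphabet) and the infinite word `0^∞` (with probability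
measure `qinf`) : from a state with context `0ⁿ1` (i.e. ending with `10ⁿ`),
a letter `α` is appended on the right with probability `q n α`, and from the
state `0^∞` with probability `qinf α`. -/
def IsCombKernel (q : ℕ → Bool → ℝ≥0∞) (qinf : Bool → ℝ≥0∞) (κ : Kernel L L) : Prop :=
  (∀ (n : ℕ) (s : L), s ∈ cylRev (List.replicate n false ++ [true]) →
      κ s = q n false • Measure.dirac (extend false s)
          + q n true • Measure.dirac (extend true s)) ∧
  κ zeroSeq = qinf false • Measure.dirac (extend false zeroSeq)
            + qinf true • Measure.dirac (extend true zeroSeq)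

/-- `cₙ` as a real number. -/
noncomputable def combCR (q : ℕ → Bool → ℝ≥0∞) (n : ℕ) : ℝ := (combC q n).toReal

/-- The rest `Rₙ = ∑_{k ≥ n} cₖ`. -/
noncomputable def combR (q : ℕ → Bool → ℝ≥0∞) (n : ℕ) : ℝ := ∑' k : ℕ, combCR q (n + k)

lemma mem_cylRev_cons {s : L} {b : Bool} {u : List Bool} :
    s ∈ cylRev (b :: u) ↔ s 0 = b ∧ (fun k => s (k + 1)) ∈ cylRev u := by
  simp only [cylRev, Set.mem_ofPred_eq, List.length_cons]
  constructor
  · intro h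
    refine ⟨by simpa using h 0 (by omega), fun i hi => ?_⟩
    simpa using h (i + 1) (by omega)
  · rintro ⟨h0, h⟩ i hi
    cases i with
    | zero => simpa using h0
    | succ i => simpa using h i (by omega)

lemma cylRev_nil : cylRev [] = Set.univ := by
  ext s; simp [cylRev]

lemma mem_cylRev_append {u v : List Bool} {s : L} :
    s ∈ cylRev (u ++ v) ↔ s ∈ cylRev u ∧ (fun k => s (u.length + k)) ∈ cylRev v := by
  induction u generalizing s with
  | nil => simp [cylRev_nil]
  | cons b u ih =>
    rw [List.cons_append, mem_cylRev_cons, mem_cylRev_cons, ih, and_assoc]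
    simp only [List.length_cons, Nat.add_right_comm]

lemma mem_cylRev_concat {u : List Bool} {b : Bool} {s : L} :
    s ∈ cylRev (u ++ [b]) ↔ s ∈ cylRev u ∧ s u.length = b := by
  simp [mem_cylRev_append, mem_cylRev_cons, cylRev_nil]

lemma mem_cylRev_replicate {n : ℕ} {b : Bool} {s : L} :
    s ∈ cylRev (List.replicate n b) ↔ ∀ i < n, s i = b := by
  simp only [cylRev, Set.mem_ofPred_eq, List.length_replicate]
  refine forall₂_congr fun i hi => ?_
  rw [List.getD_eq_getElem _ _ (by simpa using hi), List.getElem_replicate]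

lemma measurableSet_cylRev (u : List Bool) : MeasurableSet (cylRev u) := by
  simp only [cylRev, Set.ofPred_forall]
  exact MeasurableSet.iInter fun i => MeasurableSet.iInter fun _ =>
    measurable_pi_apply i (measurableSet_singleton _)

lemma extend_mem_cylRev_cons {s : L} {a b : Bool} {u : List Bool} :
    extend a s ∈ cylRev (b :: u) ↔ a = b ∧ s ∈ cylRev u := by
  rw [mem_cylRev_cons]; rfl

/-- A sequence other than `0^∞` has some `0ⁿ1` as a context. -/
lemma exists_mem_cylRev_of_ne_zeroSeq {s : L} (hs : s ≠ zeroSeq) :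
    ∃ n, s ∈ cylRev (List.replicate n false ++ [true]) := by
  have h : ∃ n, s n = true := by
    by_contra! h
    exact hs (funext fun n => by simpa [zeroSeq] using h n)
  classical
  refine ⟨Nat.find h, mem_cylRev_concat.2 ⟨mem_cylRev_replicate.2 fun i hi => ?_, ?_⟩⟩
  · simpa using Nat.find_min h hi
  · simpa using Nat.find_spec h

/-- Every word containing the letter `1` starts with some `0ᵐ1`, regardless of what follows
that letter. -/
lemma exists_replicate_append (v : List Bool) :
    ∃ m v', ∀ x, v ++ true :: x = List.replicate m false ++ true :: (v' ++ x) := by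
  induction v with
  | nil => exact ⟨0, [], by simp⟩
  | cons b v ih =>
    cases b with
    | true => exact ⟨0, v ++ [true], by simp⟩
    | false =>
      obtain ⟨m, v', h⟩ := ih
      exact ⟨m + 1, v', fun x => by simp [h, List.replicate_succ]⟩

section Comb

variable {q : ℕ → Bool → ℝ≥0∞} {qinf : Bool → ℝ≥0∞} {κ : Kernel L L} {π : Measure L}

lemma IsCombKernel.exists_eq (hκ : IsCombKernel q qinf κ) (s : L) :
    ∃ r : Bool → ℝ≥0∞, κ s = r false • Measure.dirac (extend false s)
      + r true • Measure.dirac (extend true s) := by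
  by_cases hs : s = zeroSeq
  · exact ⟨qinf, hs ▸ hκ.2⟩
  · obtain ⟨n, hn⟩ := exists_mem_cylRev_of_ne_zeroSeq hs
    exact ⟨q n, hκ.1 n s hn⟩

lemma IsCombKernel.apply_cylRev_cons (hκ : IsCombKernel q qinf κ) (n : ℕ) (b : Bool)
    (v : List Bool) (s : L) :
    κ s (cylRev (b :: (List.replicate n false ++ true :: v)))
      = (cylRev (List.replicate n false ++ true :: v)).indicator (fun _ => q n b) s := by
  by_cases hs : s ∈ cylRev (List.replicate n false ++ true :: v)
  · have hn : s ∈ cylRev (List.replicate n false ++ [true]) := by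
      have := hs
      rw [show List.replicate n false ++ true :: v
        = (List.replicate n false ++ [true]) ++ v by simp, mem_cylRev_append] at this
      exact this.1
    rw [hκ.1 n s hn]
    cases b <;>
      simp [Measure.dirac_apply' _ (measurableSet_cylRev _), Set.indicator,
        extend_mem_cylRev_cons, hs]
  · obtain ⟨r, hr⟩ := hκ.exists_eq s
    rw [hr]
    simp [Measure.dirac_apply' _ (measurableSet_cylRev _), Set.indicator,
        extend_mem_cylRev_cons, hs]

lemma IsStationary.measure_cylRev_cons (hπ : IsStationary κ π) (hκ : IsCombKernel q qinf κ)
    (n : ℕ) (b : Bool) (v : List Bool) :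
    π (cylRev (b :: (List.replicate n false ++ true :: v)))
      = q n b * π (cylRev (List.replicate n false ++ true :: v)) := by
  rw [hπ _ (measurableSet_cylRev _)]
  simp_rw [hκ.apply_cylRev_cons]
  rw [lintegral_indicator_const (measurableSet_cylRev _)]

/-- The stationary measure does not charge `0^∞`. -/
lemma IsStationary.measure_zeroSeq (hπ : IsStationary κ π) (hκ : IsCombKernel q qinf κ)
    [IsFiniteMeasure π] (hirr : qinf false ≠ 1) : π {zeroSeq} = 0 := by
  have hm : MeasurableSet ({zeroSeq} : Set L) := measurableSet_singleton _
  have hκs : ∀ s, κ s {zeroSeq} = ({zeroSeq} : Set L).indicator (fun _ => qinf false) s := by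
    have ht : ∀ s, extend true s ≠ zeroSeq := fun s h => by
      simpa [extend, zeroSeq] using congrFun h 0
    intro s
    by_cases hs : s = zeroSeq
    · have hf : extend false zeroSeq = zeroSeq := by
        funext n; cases n <;> rfl
      subst hs
      rw [hκ.2]
      simp [Measure.dirac_apply' _ hm, hf, ht]
    · have hf : extend false s ≠ zeroSeq := fun h =>
        hs (funext fun n => congrFun h (n + 1))
      obtain ⟨r, hr⟩ := hκ.exists_eq s
      rw [hr]
      simp [Measure.dirac_apply' _ hm, hf, ht, hs]
  have h := hπ _ hm
  simp_rw [hκs] at h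
  rw [lintegral_indicator_const hm] at h
  by_contra h0
  refine hirr ?_
  have h1 : 1 * π {zeroSeq} = qinf false * π {zeroSeq} := by rw [one_mul]; exact h
  exact ((ENNReal.mul_left_inj h0 (measure_ne_top _ _)).1 h1).symm

lemma combCR_succ (n : ℕ) : combCR q (n + 1) = (q n false).toReal * combCR q n := by
  rw [combCR, combC, Finset.prod_range_succ, ENNReal.toReal_mul, mul_comm]; rfl

lemma combCR_nonneg (n : ℕ) : 0 ≤ combCR q n := ENNReal.toReal_nonneg

lemma toReal_true_mul_combCR (hq : ∀ n, q n false + q n true = 1) (n : ℕ) :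
    (q n true).toReal * combCR q n = combCR q n - combCR q (n + 1) := by
  have hf : q n false ≠ ∞ := ne_top_of_le_ne_top ENNReal.one_ne_top (hq n ▸ le_self_add)
  have ht : q n true ≠ ∞ := ne_top_of_le_ne_top ENNReal.one_ne_top (hq n ▸ le_add_self)
  have h : (q n false).toReal + (q n true).toReal = 1 := by
    rw [← ENNReal.toReal_add hf ht, hq, ENNReal.toReal_one]
  rw [combCR_succ]
  linear_combination combCR q n * h

lemma combCR_succ_le (hq : ∀ n, q n false + q n true = 1) (n : ℕ) :
    0 ≤ combCR q n - combCR q (n + 1) := by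
  rw [← toReal_true_mul_combCR hq]
  exact mul_nonneg ENNReal.toReal_nonneg (combCR_nonneg n)

lemma summable_combCR (hconv : (∑' n, combC q n) ≠ ∞) : Summable (combCR q) :=
  ENNReal.summable_toReal hconv

lemma real_cyl_eq_add [IsFiniteMeasure π] (w : List Bool) :
    π.real (cyl w) = π.real (cyl (false :: w)) + π.real (cyl (true :: w)) := by
  have hu : cyl w = cyl (false :: w) ∪ cyl (true :: w) := by
    ext s
    simp only [cyl, List.reverse_cons, Set.mem_union, mem_cylRev_concat, ← and_or_left]
    cases s w.reverse.length <;> simp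
  have hd : Disjoint (cyl (false :: w)) (cyl (true :: w)) := by
    rw [Set.disjoint_left]
    intro s h h'
    simp only [cyl, List.reverse_cons, mem_cylRev_concat] at h h'
    exact Bool.false_ne_true (h.2.symm.trans h'.2)
  rw [hu, measureReal_union hd (measurableSet_cylRev _)]

lemma IsStationary.real_cylRev_cons (hπ : IsStationary κ π) (hκ : IsCombKernel q qinf κ)
    (n : ℕ) (b : Bool) (v : List Bool) :
    π.real (cylRev (b :: (List.replicate n false ++ true :: v)))
      = (q n b).toReal * π.real (cylRev (List.replicate n false ++ true :: v)) := by
  simp only [Measure.real, hπ.measure_cylRev_cons hκ, ENNReal.toReal_mul]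

/-- Renewal property: what precedes the letter `1` is independent of what follows it. -/
lemma IsStationary.real_cyl_append_true (hπ : IsStationary κ π) (hκ : IsCombKernel q qinf κ)
    {x : List Bool} {k : ℝ} (h : π.real (cyl (x ++ [true])) = k * π.real (cyl [true]))
    (w : List Bool) : π.real (cyl (x ++ true :: w)) = k * π.real (cyl (true :: w)) := by
  have key : ∀ v : List Bool, π.real (cylRev (v ++ true :: x.reverse))
      = k * π.real (cylRev (v ++ [true])) := by
    intro v
    induction v with
    | nil => simpa [cyl] using h
    | cons b v ih =>
      obtain ⟨m, v', hv⟩ := exists_replicate_append v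
      rw [hv, hv] at ih
      rw [List.cons_append, List.cons_append, hv, hv, hπ.real_cylRev_cons hκ,
        hπ.real_cylRev_cons hκ, ih]
      ring
  simpa [cyl] using key w.reverse

lemma IsStationary.real_cyl_true_replicate (hπ : IsStationary κ π)
    (hκ : IsCombKernel q qinf κ) (n : ℕ) :
    π.real (cyl (true :: List.replicate n false)) = combCR q n * π.real (cyl [true]) := by
  induction n with
  | zero => simp [combCR, combC]
  | succ n ih =>
    simp only [cyl, List.reverse_cons, List.reverse_replicate, List.reverse_nil,
      List.nil_append] at ih ⊢
    rw [List.replicate_succ, List.cons_append, hπ.real_cylRev_cons hκ, ih, combCR_succ]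
    ring

lemma IsStationary.real_cyl_true_replicate_true (hπ : IsStationary κ π)
    (hκ : IsCombKernel q qinf κ) (hq : ∀ n, q n false + q n true = 1) (n : ℕ) :
    π.real (cyl (true :: (List.replicate n false ++ [true])))
      = (combCR q n - combCR q (n + 1)) * π.real (cyl [true]) := by
  have h := hπ.real_cyl_true_replicate hκ n
  simp only [cyl, List.reverse_cons, List.reverse_replicate, List.reverse_nil,
    List.nil_append, List.reverse_append, List.cons_append] at h ⊢
  rw [hπ.real_cylRev_cons hκ, h, ← toReal_true_mul_combCR hq]
  ring

lemma IsStationary.real_cyl_replicate_true [IsFiniteMeasure π] (hπ : IsStationary κ π)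
    (hκ : IsCombKernel q qinf κ) (hq : ∀ n, q n false + q n true = 1) (n : ℕ) :
    π.real (cyl (List.replicate n false ++ [true])) = combCR q n * π.real (cyl [true]) := by
  induction n with
  | zero => simp [combCR, combC]
  | succ n ih =>
    have h := real_cyl_eq_add (π := π) (List.replicate n false ++ [true])
    rw [hπ.real_cyl_true_replicate_true hκ hq, ih] at h
    rw [List.replicate_succ, List.cons_append]
    linarith

lemma IsStationary.tendsto_real_cyl_replicate [IsFiniteMeasure π] (hπ : IsStationary κ π)
    (hκ : IsCombKernel q qinf κ) (hirr : qinf false ≠ 1) :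
    Filter.Tendsto (fun n => π.real (cyl (List.replicate n false))) Filter.atTop (nhds 0) := by
  have hinter : ⋂ n, cyl (List.replicate n false) = {zeroSeq} := by
    ext s
    simp only [cyl, List.reverse_replicate, Set.mem_iInter, mem_cylRev_replicate,
      Set.mem_singleton_iff]
    exact ⟨fun h => funext fun i => h (i + 1) i (by omega), fun h n i _ => by rw [h]; rfl⟩
  have hanti : Antitone fun n => cyl (List.replicate n false) := by
    intro m n hmn s
    simp only [cyl, List.reverse_replicate, mem_cylRev_replicate]
    exact fun h i hi => h i (by omega)
  have h := tendsto_measure_iInter_atTop (μ := π)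
    (fun n => (measurableSet_cylRev (List.replicate n false).reverse).nullMeasurableSet) hanti
    ⟨0, measure_ne_top _ _⟩
  change Filter.Tendsto (fun n => π (cyl (List.replicate n false))) _
    (nhds (π (⋂ n, cyl (List.replicate n false)))) at h
  rw [hinter, hπ.measure_zeroSeq hκ hirr] at h
  exact (ENNReal.tendsto_toReal ENNReal.zero_ne_top).comp h

lemma IsStationary.real_cyl_replicate [IsFiniteMeasure π] (hπ : IsStationary κ π)
    (hκ : IsCombKernel q qinf κ) (hirr : qinf false ≠ 1) (hconv : (∑' n, combC q n) ≠ ∞)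
    (n : ℕ) :
    π.real (cyl (List.replicate n false)) = combR q n * π.real (cyl [true]) := by
  have hpart : ∀ m, ∑ k ∈ Finset.range m, combCR q (n + k) * π.real (cyl [true])
      = π.real (cyl (List.replicate n false))
        - π.real (cyl (List.replicate (m + n) false)) := by
    intro m
    induction m with
    | zero => simp
    | succ m ih =>
      have h := real_cyl_eq_add (π := π) (List.replicate (m + n) false)
      rw [hπ.real_cyl_true_replicate hκ, ← List.replicate_succ] at h
      rw [Finset.sum_range_succ, ih, add_right_comm m 1 n, add_comm n m]
      linarith
  have hsum : Summable fun k => combCR q (n + k) := by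
    simpa only [add_comm n] using (summable_nat_add_iff n).2 (summable_combCR hconv)
  have h1 := (hsum.hasSum.mul_right (π.real (cyl [true]))).tendsto_sum_nat
  simp_rw [hpart] at h1
  have h2 := ((Filter.tendsto_add_atTop_iff_nat n).2
    (hπ.tendsto_real_cyl_replicate hκ hirr)).const_sub (π.real (cyl (List.replicate n false)))
  rw [sub_zero] at h2
  exact tendsto_nhds_unique h2 h1

end Comb

/-- Splitting a word at its first letter `1`, if any. -/
def splitAtTrue : List Bool → ℕ ⊕ ℕ × List Bool
  | [] => Sum.inl 0
  | true :: w => Sum.inr (0, w)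
  | false :: w => Sum.map (· + 1) (Prod.map (· + 1) id) (splitAtTrue w)

/-- Words are either of the form `0ⁿ` or, uniquely, of the form `0ⁿ1w`. -/
def wordEquiv : ℕ ⊕ ℕ × List Bool ≃ List Bool where
  toFun := Sum.elim (fun n => List.replicate n false)
    fun p => List.replicate p.1 false ++ true :: p.2
  invFun := splitAtTrue
  left_inv := by
    rintro (n | ⟨n, w⟩)
    · induction n with
      | zero => rfl
      | succ n ih =>
        simp only [Sum.elim_inl] at ih ⊢
        simp [List.replicate_succ, splitAtTrue, ih]
    · induction n with
      | zero => rfl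
      | succ n ih =>
        simp only [Sum.elim_inr] at ih ⊢
        simp [List.replicate_succ, splitAtTrue, ih]
  right_inv w := by
    induction w with
    | nil => rfl
    | cons b w ih =>
      cases b with
      | true => rfl
      | false =>
        rw [splitAtTrue]
        cases h : splitAtTrue w <;> rw [h] at ih <;> simp at ih <;>
          simp [List.replicate_succ, ih]

/-- If `f (0ⁿ1w) = a n * g w`, the sum of `f` over words splits at the first letter `1`. -/
lemma tsum_words {f g : List Bool → ℂ} {a : ℕ → ℂ} (hf : Summable fun w => ‖f w‖)
    (hg : Summable fun w => ‖g w‖) (ha : Summable fun n => ‖a n‖)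
    (hfg : ∀ n w, f (List.replicate n false ++ true :: w) = a n * g w) :
    ∑' w, f w = ∑' n, f (List.replicate n false) + (∑' n, a n) * ∑' w, g w := by
  have hs : Summable fun p => f (wordEquiv p) := wordEquiv.summable_iff.2 hf.of_norm
  have hl : Summable fun n => f (wordEquiv (Sum.inl n)) := hs.comp_injective Sum.inl_injective
  have hr : Summable fun p => f (wordEquiv (Sum.inr p)) := hs.comp_injective Sum.inr_injective
  have hinl : ∀ n, wordEquiv (Sum.inl n) = List.replicate n false := fun _ => rfl
  have hinr : ∀ p, wordEquiv (Sum.inr p) = List.replicate p.1 false ++ true :: p.2 :=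
    fun _ => rfl
  rw [tsum_mul_tsum_of_summable_norm ha hg, ← wordEquiv.tsum_eq f,
    Summable.tsum_sum (f := fun p => f (wordEquiv p)) hl hr]
  simp only [hinl, hinr, hfg]

/-- The Dirichlet series `Λ(s) = ∑_{w ∈ W} π(w)^s` of the
source obtained from a stationary infinite comb satisfies, on a vertical strip
where all the involved series converge (and where the denominator does not
vanish) :
`Λ(s) = S(1)^{-s} [ ∑ₙ Rₙ^s + (∑ₙ cₙ^s)² / (1 - ∑ₙ (cₙ - cₙ₊₁)^s) ]`. -/
theorem comb_dirichlet_series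
    (q : ℕ → Bool → ℝ≥0∞) (qinf : Bool → ℝ≥0∞)
    (hq : ∀ n, q n false + q n true = 1) (hqinf : qinf false + qinf true = 1)
    (hirr : qinf false ≠ 1) (hconv : (∑' n, combC q n) ≠ ∞)
    (κ : Kernel L L) [IsMarkovKernel κ] (hκ : IsCombKernel q qinf κ)
    (π : Measure L) [IsProbabilityMeasure π] (hπ : IsStationary κ π)
    (s : ℂ)
    (hΛ : Summable (fun w : List Bool => ‖((π (cyl w)).toReal : ℂ) ^ s‖))
    (hR : Summable (fun n : ℕ => ‖((combR q n : ℝ) : ℂ) ^ s‖))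
    (hc : Summable (fun n : ℕ => ‖((combCR q n : ℝ) : ℂ) ^ s‖))
    (hd : Summable (fun n : ℕ => ‖((combCR q n - combCR q (n + 1) : ℝ) : ℂ) ^ s‖))
    (hden : (1 : ℂ) - ∑' n : ℕ, ((combCR q n - combCR q (n + 1) : ℝ) : ℂ) ^ s ≠ 0) :
    ∑' w : List Bool, ((π (cyl w)).toReal : ℂ) ^ s
      = ((∑' n : ℕ, combCR q n : ℝ) : ℂ) ^ (-s) *
        (∑' n : ℕ, ((combR q n : ℝ) : ℂ) ^ s
          + (∑' n : ℕ, ((combCR q n : ℝ) : ℂ) ^ s) ^ 2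
            / (1 - ∑' n : ℕ, ((combCR q n - combCR q (n + 1) : ℝ) : ℂ) ^ s)) := by
  change Summable (fun w : List Bool => ‖((π.real (cyl w) : ℝ) : ℂ) ^ s‖) at hΛ
  change ∑' w : List Bool, ((π.real (cyl w) : ℝ) : ℂ) ^ s = _
  set m := π.real (cyl [true])
  have hm0 : 0 ≤ m := measureReal_nonneg
  have hR0 : ∀ n, 0 ≤ combR q n := fun n => tsum_nonneg fun k => combCR_nonneg _
  have hmS : (∑' n, combCR q n) * m = 1 := by
    have h := hπ.real_cyl_replicate hκ hirr hconv 0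
    rw [combR, List.replicate_zero, cyl, List.reverse_nil, cylRev_nil, probReal_univ] at h
    simpa only [zero_add] using h.symm
  have hS0 : 0 ≤ ∑' n, combCR q n := tsum_nonneg combCR_nonneg
  have hmS' : m = (∑' n, combCR q n)⁻¹ := eq_inv_of_mul_eq_one_right hmS
  have hmpow : (m : ℂ) ^ s = ((∑' n, combCR q n : ℝ) : ℂ) ^ (-s) := by
    rw [hmS', Complex.ofReal_inv, Complex.cpow_neg, Complex.inv_cpow]
    rw [Complex.arg_ofReal_of_nonneg hS0]
    exact Real.pi_ne_zero.symm
  have hinj : Function.Injective fun w : List Bool => true :: w :=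
    fun _ _ h => List.tail_eq_of_cons_eq h
  have hG : Summable (fun w : List Bool => ‖((π.real (cyl (true :: w)) : ℝ) : ℂ) ^ s‖) :=
    hΛ.comp_injective hinj
  have e1 := tsum_words hΛ hG hc fun n w => by
    rw [hπ.real_cyl_append_true hκ (hπ.real_cyl_replicate_true hκ hq n), Complex.ofReal_mul,
      Complex.mul_cpow_ofReal_nonneg (combCR_nonneg n) measureReal_nonneg]
  have e2 := tsum_words hG hG hd fun n w => by
    have h := hπ.real_cyl_append_true hκ (x := true :: List.replicate n false)
      (hπ.real_cyl_true_replicate_true hκ hq n) w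
    rw [List.cons_append] at h
    rw [h, Complex.ofReal_mul,
      Complex.mul_cpow_ofReal_nonneg (combCR_succ_le hq n) measureReal_nonneg]
  have hR' : ∀ n, ((π.real (cyl (List.replicate n false)) : ℝ) : ℂ) ^ s
      = ((combR q n : ℝ) : ℂ) ^ s * (m : ℂ) ^ s := fun n => by
    rw [hπ.real_cyl_replicate hκ hirr hconv, Complex.ofReal_mul,
      Complex.mul_cpow_ofReal_nonneg (hR0 n) hm0]
  have hc' : ∀ n, ((π.real (cyl (true :: List.replicate n false)) : ℝ) : ℂ) ^ s
      = ((combCR q n : ℝ) : ℂ) ^ s * (m : ℂ) ^ s := fun n => by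
    rw [hπ.real_cyl_true_replicate hκ, Complex.ofReal_mul,
      Complex.mul_cpow_ofReal_nonneg (combCR_nonneg n) hm0]
  rw [tsum_congr hR', tsum_mul_right] at e1
  rw [tsum_congr hc', tsum_mul_right] at e2
  rw [e1, ← hmpow, mul_add, mul_comm (_ ^ s)]
  congr 1
  rw [mul_div_assoc', eq_div_iff hden]
  linear_combination (∑' n : ℕ, ((combCR q n : ℝ) : ℂ) ^ s) * e2

end VLMC
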